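/- For every nonzero positive semidefinite d×d matrix ρ, the rate function I_ρ is lower semicontinuous as a function from the space of Hermitian d×d matrices to the extended reals (−∞,∞]. -/

import Mathlib

open Matrix
open scoped ComplexOrder

noncomputable section
open scoped Classical

/-- Square complex matrices of size `d`. -/
abbrev Mat (d : ℕ) := Matrix (Fin d) (Fin d) ℂ

/-- `n` is upper triangular with all diagonal entries equal to `1`. -/
def IsUnitUpperTriangular {d : ℕ} (n : Mat d) : Prop :=
  n.BlockTriangular (id : Fin d → Fin d) ∧ ∀ i, n i i = 1

/-- `a` is diagonal with positive real diagonal entries. -/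
def IsPosDiagonal {d : ℕ} (a : Mat d) : Prop :=
  ∃ f : Fin d → ℝ, (∀ i, 0 < f i) ∧ a = Matrix.diagonal (fun i => (f i : ℂ))

/-- `(k, a, n)` is an Iwasawa (QR) decomposition of `g`: `g = k a n` with `k` unitary,
`a` diagonal with positive real diagonal entries and `n` unit upper triangular. -/
def IsIwasawa {d : ℕ} (g k a n : Mat d) : Prop :=
  g = k * a * n ∧ k ∈ Matrix.unitaryGroup (Fin d) ℂ ∧ IsPosDiagonal a ∧ IsUnitUpperTriangular n

/-- A choice of the (unique) Iwasawa decomposition `(k(g), a(g), n(g))` of `g`. -/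
def iwaTriple {d : ℕ} (g : Mat d) : Mat d × Mat d × Mat d :=
  if h : ∃ t : Mat d × Mat d × Mat d, IsIwasawa g t.1 t.2.1 t.2.2 then h.choose else (1, 1, 1)

/-- The unitary factor `k(g)` in the Iwasawa decomposition of `g`. -/
def iwaK {d : ℕ} (g : Mat d) : Mat d := (iwaTriple g).1

/-- `α(g) = log a(g)`, a real diagonal matrix. -/
def iwaAlpha {d : ℕ} (g : Mat d) : Matrix (Fin d) (Fin d) ℝ :=
  Matrix.diagonal (fun i => Real.log (((iwaTriple g).2.1 i i).re))

/-- `x = h * diagonal f * h*` with `h` unitary and `f` real and nonincreasing. -/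
def IsOrderedDiagonalization {d : ℕ} (x : Mat d) (h : Mat d) (f : Fin d → ℝ) : Prop :=
  h ∈ Matrix.unitaryGroup (Fin d) ℂ ∧ Antitone f ∧
    x = h * Matrix.diagonal (fun i => (f i : ℂ)) * star h

/-- A choice of an ordered spectral decomposition `x = h x₀ h*` of a hermitian matrix. -/
def specPair {d : ℕ} (x : Mat d) : Mat d × (Fin d → ℝ) :=
  if h : ∃ p : Mat d × (Fin d → ℝ), IsOrderedDiagonalization x p.1 p.2 then h.choose else (1, 0)

/-- `χ_x(g) = exp (2 Tr (x₀ α(g h)))` where `x = h x₀ h*` (independent of the choice of `h`). -/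
def chi {d : ℕ} (x g : Mat d) : ℝ :=
  Real.exp (2 * Matrix.trace (Matrix.diagonal (specPair x).2 * iwaAlpha (g * (specPair x).1)))

/-- The rate function `I_ρ(x) = sup_{g ∈ GL(d,ℂ)} (-ln χ_x(g⁻¹) - ln Tr(g* ρ g))`,
with values in `(-∞, ∞]`. -/
def rate {d : ℕ} (ρ x : Mat d) : EReal :=
  ⨆ g : GL (Fin d) ℂ,
    ((- Real.log (chi x (↑g⁻¹ : Mat d))
      - Real.log ((Matrix.trace (star (↑g : Mat d) * ρ * (↑g : Mat d))).re) : ℝ) : EReal)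

/-- The leading principal block of order `k`. -/
def leadingBlock {d : ℕ} (k : ℕ) (M : Mat d) :
    Matrix {i : Fin d // (i : ℕ) < k} {i : Fin d // (i : ℕ) < k} ℂ :=
  M.toBlock (fun i => (i : ℕ) < k) (fun i => (i : ℕ) < k)

/-- The leading principal minor of order `k`. -/
def leadingMinor {d : ℕ} (k : ℕ) (M : Mat d) : ℂ :=
  (leadingBlock k M).det

lemma leadingBlock_mul {d : ℕ} (k : ℕ) (A X : Mat d)
    (hX : ∀ i j : Fin d, k ≤ i → (j : ℕ) < k → X i j = 0) :
    leadingBlock k (A * X) = leadingBlock k A * leadingBlock k X := by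
  have h0 : X.toBlock (fun i => ¬ (i : ℕ) < k) (fun i => (i : ℕ) < k) = 0 := by
    ext i j
    exact hX i j (not_lt.mp i.2) j.2
  rw [leadingBlock, toBlock_mul_eq_add (fun i : Fin d => (i : ℕ) < k) (fun i : Fin d => (i : ℕ) < k), h0,
    Matrix.mul_zero, add_zero]
  rfl

lemma leadingBlock_conjTranspose {d : ℕ} (k : ℕ) (M : Mat d) :
    leadingBlock k Mᴴ = (leadingBlock k M)ᴴ := rfl

lemma leadingMinor_conj {d : ℕ} (k : ℕ) (M X : Mat d)
    (hX : ∀ i j : Fin d, k ≤ i → (j : ℕ) < k → X i j = 0) :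
    leadingMinor k (Xᴴ * M * X) = star (leadingMinor k X) * leadingMinor k M * leadingMinor k X := by
  have h : leadingBlock k (Xᴴ * M) = (leadingBlock k X)ᴴ * leadingBlock k M := by
    rw [← conjTranspose_conjTranspose (leadingBlock k (Xᴴ * M)), ← leadingBlock_conjTranspose,
      conjTranspose_mul, conjTranspose_conjTranspose, leadingBlock_mul k _ X hX,
      leadingBlock_conjTranspose, conjTranspose_mul, conjTranspose_conjTranspose]
  simp only [leadingMinor, leadingBlock_mul k _ X hX, h, det_mul, det_conjTranspose]

lemma exists_isIwasawa {d : ℕ} {g : Mat d} (hg : IsUnit g) :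
    ∃ t : Mat d × Mat d × Mat d, IsIwasawa g t.1 t.2.1 t.2.2 := by
  set v : Fin d → EuclideanSpace ℂ (Fin d) := fun j => WithLp.toLp 2 (gᵀ j)
  have hli : LinearIndependent ℂ v := by
    have h := (Matrix.linearIndependent_cols_iff_isUnit (A := g)).mpr hg
    exact h.map' (WithLp.linearEquiv 2 ℂ (Fin d → ℂ)).symm.toLinearMap (LinearEquiv.ker _)
  set b := InnerProductSpace.gramSchmidt ℂ v with hb
  have hb0 : ∀ j, b j ≠ 0 := fun j => InnerProductSpace.gramSchmidt_ne_zero j hli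
  set e := InnerProductSpace.gramSchmidtNormed ℂ v with he
  have heo : Orthonormal ℂ e := InnerProductSpace.gramSchmidtNormed_orthonormal hli
  set K : Mat d := Matrix.of fun i j => e j i
  have hKK : Kᴴ * K = 1 := by
    ext i j
    have h := orthonormal_iff_ite.mp heo i j
    rw [one_apply, ← h, mul_apply, PiLp.inner_apply]
    exact Finset.sum_congr rfl fun k _ => by simp [K, mul_comm]
  have hKK' : K * Kᴴ = 1 := mul_eq_one_comm.mp hKK
  have hR : ∀ i j, (Kᴴ * g) i j = ((‖b i‖ : ℂ))⁻¹ * inner ℂ (b i) (v j) := by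
    intro i j
    have : inner ℂ (e i) (v j) = ((‖b i‖ : ℂ))⁻¹ * inner ℂ (b i) (v j) := by
      rw [he, InnerProductSpace.gramSchmidtNormed, inner_smul_left]
      simp [b]
    rw [← this, mul_apply, PiLp.inner_apply]
    exact Finset.sum_congr rfl fun k _ => by simp [K, v, mul_comm]
  have hdiag : ∀ i, inner ℂ (b i) (v i) = (‖b i‖ : ℂ) ^ 2 := by
    intro i
    rw [InnerProductSpace.gramSchmidt_def' ℂ v i, inner_add_right, inner_sum,
      Finset.sum_eq_zero, add_zero]
    · exact inner_self_eq_norm_sq_to_K _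
    · intro k hk
      rw [Submodule.starProjection_singleton, inner_smul_right,
        InnerProductSpace.gramSchmidt_orthogonal ℂ v (Finset.mem_Iio.mp hk).ne', mul_zero]
  have hn0 : ∀ i, (‖b i‖ : ℂ) ≠ 0 := fun i => by simpa using hb0 i
  refine ⟨(K, diagonal (fun i => ((‖b i‖ : ℝ) : ℂ)),
    diagonal (fun i => ((‖b i‖ : ℝ) : ℂ)⁻¹) * (Kᴴ * g)), ?_, ?_, ?_, ?_, ?_⟩
  · have : (diagonal (fun i => ((‖b i‖ : ℝ) : ℂ)) : Mat d) *
        diagonal (fun i => ((‖b i‖ : ℝ) : ℂ)⁻¹) = 1 := by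
      rw [diagonal_mul_diagonal, ← diagonal_one]
      congr 1
      ext i
      exact mul_inv_cancel₀ (hn0 i)
    calc g = K * (1 * (Kᴴ * g)) := by rw [one_mul, ← mul_assoc, hKK', one_mul]
      _ = _ := by rw [← this]; simp only [mul_assoc]
  · exact mem_unitaryGroup_iff.mpr hKK'
  · exact ⟨fun i => ‖b i‖, fun i => norm_pos_iff.mpr (hb0 i), rfl⟩
  · intro i j hij
    have h : inner ℂ (b i) (v j) = 0 := InnerProductSpace.gramSchmidt_inv_triangular ℂ v hij
    simp only
    rw [diagonal_mul, hR, h, mul_zero, mul_zero]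
  · intro i
    simp only
    rw [diagonal_mul, hR, hdiag]
    have := hn0 i
    field_simp

lemma exists_iwaAlpha_leadingMinor {d : ℕ} {A : Mat d} (hA : IsUnit A) :
    ∃ f : Fin d → ℝ, (∀ i, 0 < f i) ∧ (∀ i, iwaAlpha A i i = Real.log (f i)) ∧
      ∀ k, leadingMinor k (Aᴴ * A) =
        ((∏ i : {i : Fin d // (i : ℕ) < k}, f i ^ 2 : ℝ) : ℂ) := by
  have hex := exists_isIwasawa hA
  have ht : IsIwasawa A (iwaTriple A).1 (iwaTriple A).2.1 (iwaTriple A).2.2 := by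
    rw [iwaTriple, dif_pos hex]
    exact hex.choose_spec
  have hα : ∀ i, iwaAlpha A i i = Real.log (((iwaTriple A).2.1 i i).re) := fun i => by
    simp [iwaAlpha]
  generalize iwaTriple A = t at ht hα
  obtain ⟨k, a, n⟩ := t
  obtain ⟨hA', hk, ⟨f, hf, ha⟩, hn, hn1⟩ := ht
  simp only at hA' hk ha hn hn1 hα
  refine ⟨f, hf, fun i => by rw [hα, ha]; simp, fun m => ?_⟩
  have hk' : kᴴ * k = 1 := mem_unitaryGroup_iff'.mp hk
  have h1 : Aᴴ * A = nᴴ * (diagonal fun i => ((f i ^ 2 : ℝ) : ℂ)) * n := by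
    have haa : aᴴ * a = diagonal fun i => ((f i ^ 2 : ℝ) : ℂ) := by
      rw [ha, diagonal_conjTranspose, diagonal_mul_diagonal]
      congr 1
      ext i
      simp [pow_two]
    rw [← haa, hA', conjTranspose_mul, conjTranspose_mul]
    calc _ = nᴴ * (aᴴ * (kᴴ * k) * a) * n := by simp only [mul_assoc]
      _ = _ := by rw [hk', mul_one]
  have hdet : leadingMinor m n = 1 := by
    rw [leadingMinor, det_of_isUpperTriangular]
    · exact Finset.prod_eq_one fun i _ => hn1 i
    · intro i j hij
      exact hn hij
  rw [h1, leadingMinor_conj, hdet, leadingMinor, leadingBlock, toBlock_diagonal_self,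
    det_diagonal]
  · simp
  · intro i j hi hj
    exact hn (show (j : Fin d) < i from Fin.lt_def.mpr (hj.trans_le hi))

lemma leadingMinor_re_pos {d : ℕ} {A : Mat d} (hA : IsUnit A) (k : ℕ) :
    0 < (leadingMinor k (Aᴴ * A)).re := by
  obtain ⟨f, hf, -, h⟩ := exists_iwaAlpha_leadingMinor hA
  rw [h, Complex.ofReal_re]
  exact Finset.prod_pos fun i _ => pow_pos (hf i) 2

lemma log_leadingMinor_sub {d : ℕ} {A : Mat d} (hA : IsUnit A) (i : Fin d) :
    Real.log (leadingMinor (i + 1) (Aᴴ * A)).re - Real.log (leadingMinor i (Aᴴ * A)).re =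
      2 * iwaAlpha A i i := by
  obtain ⟨f, hf, hα, h⟩ := exists_iwaAlpha_leadingMinor hA
  have key : ∀ k, Real.log (leadingMinor k (Aᴴ * A)).re =
      ∑ j ∈ Finset.univ.filter fun j : Fin d => (j : ℕ) < k, 2 * Real.log (f j) := by
    intro k
    rw [h, Complex.ofReal_re, Real.log_prod (fun j _ => (pow_pos (hf j.1) 2).ne')]
    simp only [Real.log_pow, Nat.cast_ofNat]
    exact (Finset.sum_subtype _ (by intro; simp) fun j => 2 * Real.log (f j)).symm
  have hins : (Finset.univ.filter fun j : Fin d => (j : ℕ) < i + 1) =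
      insert i (Finset.univ.filter fun j : Fin d => (j : ℕ) < i) := by
    ext j
    simp [Fin.ext_iff]
    omega
  rw [key, key, hins, Finset.sum_insert (by simp), hα]
  ring

/-- `2 Tr(diag(f) α(A))` in terms of the leading principal minors of `A* A`. -/
lemma two_mul_trace_iwaAlpha {d : ℕ} {A : Mat d} (hA : IsUnit A) (f : Fin d → ℝ) :
    2 * trace (diagonal f * iwaAlpha A) = ∑ i : Fin d, f i *
      (Real.log (leadingMinor (i + 1) (Aᴴ * A)).re - Real.log (leadingMinor i (Aᴴ * A)).re) := by
  rw [trace, Finset.mul_sum]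
  refine Finset.sum_congr rfl fun i _ => ?_
  rw [log_leadingMinor_sub hA, diag_apply, diagonal_mul]
  ring

/-- Abel summation when `D` vanishes at `0` and wherever `f` jumps. -/
lemma sum_mul_increments {m : ℕ} (f : Fin (m + 1) → ℝ) (D : ℕ → ℝ) (h0 : D 0 = 0)
    (hjump : ∀ i j : Fin (m + 1), (i : ℕ) + 1 = j → f i ≠ f j → D j = 0) :
    ∑ i, f i * (D (i + 1) - D i) = f (Fin.last m) * D (m + 1) := by
  induction m with
  | zero => simp [h0]
  | succ m ih =>
    rw [Fin.sum_univ_castSucc]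
    have := ih (fun i => f i.castSucc) fun i j hij hf => hjump i.castSucc j.castSucc hij hf
    simp only [Fin.val_castSucc, Fin.val_last] at this ⊢
    rw [this]
    by_cases hf : f (Fin.last m).castSucc = f (Fin.last (m + 1))
    · rw [hf]
      ring
    · have h := hjump (Fin.last m).castSucc (Fin.last (m + 1)) (by simp) hf
      rw [Fin.val_last] at h
      rw [h]
      ring

lemma IsOrderedDiagonalization.snd_unique {d : ℕ} {x h h' : Mat d} {f f' : Fin d → ℝ}
    (hx : IsOrderedDiagonalization x h f) (hx' : IsOrderedDiagonalization x h' f') : f = f' := by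
  have key : ∀ {h : Mat d} {f : Fin d → ℝ}, IsOrderedDiagonalization x h f →
      x.charpoly.roots = Finset.univ.val.map fun i => (f i : ℂ) := by
    rintro h f ⟨hh, -, rfl⟩
    rw [mul_assoc, charpoly_mul_comm, mul_assoc, mem_unitaryGroup_iff'.mp hh, mul_one,
      charpoly_diagonal]
    have := Polynomial.roots_multiset_prod_X_sub_C (Finset.univ.val.map fun i => (f i : ℂ))
    rw [Multiset.map_map] at this
    exact this
  have hroots := (key hx).symm.trans (key hx')
  have hre := congrArg (Multiset.map Complex.re) hroots
  simp only [Multiset.map_map, Function.comp_def, Complex.ofReal_re] at hre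
  have hperm : (List.ofFn f).Perm (List.ofFn f') := by
    rw [← Multiset.coe_eq_coe, ← Fin.univ_val_map, ← Fin.univ_val_map]
    exact hre
  exact List.ofFn_injective (hperm.eq_of_sortedGE hx.2.1.sortedGE_ofFn hx'.2.1.sortedGE_ofFn)

lemma exists_isOrderedDiagonalization {d : ℕ} {x : Mat d} (hx : x.IsHermitian) :
    ∃ p : Mat d × (Fin d → ℝ), IsOrderedDiagonalization x p.1 p.2 := by
  set U : Mat d := (hx.eigenvectorUnitary : Mat d)
  set σ := Tuple.sort (-hx.eigenvalues)
  have hUU : U * Uᴴ = 1 := mem_unitaryGroup_iff.mp hx.eigenvectorUnitary.2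
  refine ⟨(U.submatrix id σ, hx.eigenvalues ∘ σ), ?_, ?_, ?_⟩
  · rw [mem_unitaryGroup_iff, star_eq_conjTranspose, conjTranspose_submatrix,
      submatrix_mul_equiv, hUU, submatrix_id_id]
  · intro i j hij
    have := Tuple.monotone_sort (-hx.eigenvalues) hij
    simpa using this
  · have hd : (diagonal fun i => (((hx.eigenvalues ∘ σ) i : ℝ) : ℂ) : Mat d) =
        (diagonal fun i => ((hx.eigenvalues i : ℝ) : ℂ)).submatrix σ σ := by
      rw [submatrix_diagonal_equiv]
      rfl
    rw [hd, star_eq_conjTranspose, conjTranspose_submatrix, submatrix_mul_equiv,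
      submatrix_mul_equiv, submatrix_id_id]
    exact hx.spectral_theorem

lemma specPair_spec {d : ℕ} {x : Mat d} (hx : x.IsHermitian) :
    IsOrderedDiagonalization x (specPair x).1 (specPair x).2 := by
  have hex := exists_isOrderedDiagonalization hx
  rw [specPair, dif_pos hex]
  exact hex.choose_spec

lemma isUnit_of_mem_unitaryGroup {d : ℕ} {h : Mat d} (hh : h ∈ unitaryGroup (Fin d) ℂ) :
    IsUnit h :=
  ⟨⟨h, star h, mem_unitaryGroup_iff.mp hh, mem_unitaryGroup_iff'.mp hh⟩, rfl⟩

/-- Two diagonalizing unitaries give the same leading minors at the jumps of the eigenvalues. -/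
lemma leadingMinor_eq_of_isOrderedDiagonalization {d : ℕ} {x h h' : Mat d} {f : Fin d → ℝ}
    (hx : IsOrderedDiagonalization x h f) (hx' : IsOrderedDiagonalization x h' f) (g : Mat d)
    {k : ℕ} (hk : ∀ i j : Fin d, (j : ℕ) < k → k ≤ i → f i ≠ f j) :
    leadingMinor k ((g * h')ᴴ * (g * h')) = leadingMinor k ((g * h)ᴴ * (g * h)) := by
  obtain ⟨hh, -, hx⟩ := hx
  obtain ⟨hh', -, hx'⟩ := hx'
  have e1 : h * hᴴ = 1 := mem_unitaryGroup_iff.mp hh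
  have e1' : hᴴ * h = 1 := mem_unitaryGroup_iff'.mp hh
  have e2 : h' * h'ᴴ = 1 := mem_unitaryGroup_iff.mp hh'
  have e2' : h'ᴴ * h' = 1 := mem_unitaryGroup_iff'.mp hh'
  rw [star_eq_conjTranspose] at hx hx'
  set u := hᴴ * h' with hu
  have huu : uᴴ * u = 1 := by
    rw [hu, conjTranspose_mul, conjTranspose_conjTranspose]
    calc _ = h'ᴴ * (h * hᴴ) * h' := by simp only [mul_assoc]
      _ = 1 := by rw [e1, mul_one, e2']
  have hcomm : u * diagonal (fun i => (f i : ℂ)) = diagonal (fun i => (f i : ℂ)) * u := by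
    calc u * diagonal (fun i => (f i : ℂ))
        = hᴴ * (h' * diagonal (fun i => (f i : ℂ)) * h'ᴴ) * h' := by
          simp only [hu, mul_assoc, e2', mul_one]
      _ = hᴴ * (h * diagonal (fun i => (f i : ℂ)) * hᴴ) * h' := by rw [← hx', ← hx]
      _ = (hᴴ * h) * diagonal (fun i => (f i : ℂ)) * (hᴴ * h') := by simp only [mul_assoc]
      _ = _ := by rw [e1', one_mul]
  have hu0 : ∀ i j : Fin d, k ≤ i → (j : ℕ) < k → u i j = 0 := by
    intro i j hi hj
    have h1 := congrFun (congrFun hcomm i) j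
    rw [mul_diagonal, diagonal_mul] at h1
    have h2 : ((f i : ℂ) - f j) * u i j = 0 := by linear_combination -h1
    refine (mul_eq_zero.mp h2).resolve_left ?_
    exact sub_ne_zero.mpr (by exact_mod_cast hk i j hj hi)
  have hone := leadingMinor_conj k 1 u hu0
  have hone' : leadingMinor k (1 : Mat d) = 1 := by
    rw [leadingMinor, leadingBlock, toBlock_one_self, det_one]
  rw [mul_one, huu, hone', mul_one] at hone
  have hh'u : h' = h * u := by rw [hu, ← mul_assoc, e1, one_mul]
  have hg : (g * h')ᴴ * (g * h') = uᴴ * ((g * h)ᴴ * (g * h)) * u := by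
    rw [hh'u]
    simp only [conjTranspose_mul, mul_assoc]
  rw [hg, leadingMinor_conj k _ u hu0, mul_right_comm, ← hone, one_mul]

/-- Independence of `χ` from the diagonalization. -/
lemma trace_iwaAlpha_eq_of_isOrderedDiagonalization {d : ℕ} {x h h' : Mat d}
    {f f' : Fin d → ℝ} (hx : IsOrderedDiagonalization x h f)
    (hx' : IsOrderedDiagonalization x h' f') {g : Mat d} (hg : IsUnit g) :
    2 * trace (diagonal f * iwaAlpha (g * h)) =
      2 * trace (diagonal f' * iwaAlpha (g * h')) := by
  obtain rfl := hx.snd_unique hx'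
  rw [two_mul_trace_iwaAlpha (hg.mul (isUnit_of_mem_unitaryGroup hx.1)),
    two_mul_trace_iwaAlpha (hg.mul (isUnit_of_mem_unitaryGroup hx'.1)), ← sub_eq_zero,
    ← Finset.sum_sub_distrib]
  set D : ℕ → ℝ := fun k => Real.log (leadingMinor k ((g * h)ᴴ * (g * h))).re -
    Real.log (leadingMinor k ((g * h')ᴴ * (g * h'))).re with hD
  have hD0 : ∀ k, (∀ i j : Fin d, (j : ℕ) < k → k ≤ i → f i ≠ f j) → D k = 0 := by
    intro k hk
    rw [hD]
    simp only
    rw [leadingMinor_eq_of_isOrderedDiagonalization hx hx' g hk, sub_self]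
  calc _ = ∑ i, f i * (D (i + 1) - D i) := by
        refine Finset.sum_congr rfl fun i _ => ?_
        rw [hD]
        ring
    _ = 0 := by
      clear_value D
      cases d with
      | zero => simp
      | succ m =>
        rw [sum_mul_increments f D (hD0 0 fun i j hj => by omega) ?_,
          hD0 (m + 1) fun i j _ hi => by omega, mul_zero]
        intro i j hij hne
        refine hD0 j fun a b hb ha => ?_
        have h1 : f a ≤ f j := hx.2.1 (Fin.le_def.mpr ha)
        have h2 : f i ≤ f b := hx.2.1 (Fin.le_def.mpr (by omega))
        have h3 : f j ≤ f i := hx.2.1 (Fin.le_def.mpr (by omega))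
        have h4 : f j < f i := lt_of_le_of_ne h3 hne.symm
        exact (h1.trans_lt (h4.trans_le h2)).ne

lemma isCompact_unitaryGroup (d : ℕ) : IsCompact (unitaryGroup (Fin d) ℂ : Set (Mat d)) := by
  have hc : IsCompact {M : Mat d | ∀ i, M i ∈ {r : Fin d → ℂ |
      ∀ j, r j ∈ Metric.closedBall (0 : ℂ) 1}} :=
    isCompact_pi_infinite fun _ => isCompact_pi_infinite fun _ => isCompact_closedBall 0 1
  refine hc.of_isClosed_subset isClosed_unitary fun M hM i j => ?_
  rw [mem_closedBall_zero_iff]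
  exact entry_norm_bound_of_unitary hM i j

lemma continuousAt_log_leadingMinor {d : ℕ} {g h : Mat d} (hgh : IsUnit (g * h)) (k : ℕ) :
    ContinuousAt (fun y : Mat d => Real.log (leadingMinor k ((g * y)ᴴ * (g * y))).re) h := by
  refine ContinuousAt.log ?_ (leadingMinor_re_pos hgh k).ne'
  refine (Complex.continuous_re.comp ?_).continuousAt
  refine Continuous.matrix_det
    (Continuous.matrix_submatrix (A := fun y => (g * y)ᴴ * (g * y)) ?_ _ _)
  fun_prop

lemma continuous_log_chi {d : ℕ} {g : Mat d} (hg : IsUnit g) :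
    Continuous fun x : {x : Mat d // x.IsHermitian} => Real.log (chi (x : Mat d) g) := by
  simp only [chi, Real.log_exp]
  refine continuous_iff_continuousAt.mpr fun x => (Filter.tendsto_iff_ultrafilter _ _ _).mpr fun U hU => ?_
  set H : {x : Mat d // x.IsHermitian} → Mat d := fun y => (specPair (y : Mat d)).1 with hH
  set F : {x : Mat d // x.IsHermitian} → Fin d → ℝ := fun y => (specPair (y : Mat d)).2 with hF
  have hs : ∀ y : {x : Mat d // x.IsHermitian}, IsOrderedDiagonalization (y : Mat d) (H y) (F y) := fun y => specPair_spec y.2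
  obtain ⟨h, hh, hlim⟩ := (isCompact_unitaryGroup d).ultrafilter_le_nhds (U.map H)
    (Filter.le_principal_iff.mpr (Filter.mem_map.mpr
      (Filter.Eventually.of_forall fun y => (hs y).1)))
  have hHlim : Filter.Tendsto H U (nhds h) := hlim
  have hxlim : Filter.Tendsto (fun y : {x : Mat d // x.IsHermitian} => (y : Mat d)) U
      (nhds (x : Mat d)) := (continuous_subtype_val.tendsto x).mono_left hU
  have hdiag : ∀ y, (H y)ᴴ * (y : Mat d) * H y = diagonal fun i => (F y i : ℂ) := by
    intro y
    have e : (H y)ᴴ * H y = 1 := mem_unitaryGroup_iff'.mp (hs y).1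
    conv_lhs => rw [(hs y).2.2, star_eq_conjTranspose]
    calc _ = ((H y)ᴴ * H y) * diagonal (fun i => (F y i : ℂ)) * ((H y)ᴴ * H y) := by
          simp only [mul_assoc]
      _ = _ := by rw [e, one_mul, mul_one]
  have hDlim : Filter.Tendsto (fun y => diagonal fun i => (F y i : ℂ)) U
      (nhds (hᴴ * (x : Mat d) * h)) := by
    simp only [← hdiag]
    have hstar : Filter.Tendsto (fun y => (H y)ᴴ) U (nhds hᴴ) :=
      ((continuous_id.matrix_conjTranspose).tendsto h).comp hHlim
    exact (hstar.mul hxlim).mul hHlim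
  set f : Fin d → ℝ := fun i => ((hᴴ * (x : Mat d) * h) i i).re with hf
  have hFlim : ∀ i, Filter.Tendsto (fun y => F y i) U (nhds (f i)) := by
    intro i
    have h1 : Continuous fun M : Mat d => (M i i).re :=
      Complex.continuous_re.comp (continuous_id.matrix_elem i i)
    have := (h1.tendsto _).comp hDlim
    simpa [Function.comp_def] using this
  have hx : IsOrderedDiagonalization (x : Mat d) h f := by
    refine ⟨hh, fun i j hij => ?_, ?_⟩
    · exact le_of_tendsto_of_tendsto' (hFlim j) (hFlim i) fun y => (hs y).2.1 hij
    · have hc : Continuous fun r : Fin d → ℝ => (diagonal fun i => (r i : ℂ) : Mat d) :=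
        Continuous.matrix_diagonal (by fun_prop)
      have h1 : Filter.Tendsto (fun y => (diagonal fun i => (F y i : ℂ) : Mat d)) U
          (nhds (diagonal fun i => (f i : ℂ))) :=
        (hc.tendsto f).comp (tendsto_pi_nhds.mpr hFlim)
      have e : h * hᴴ = 1 := mem_unitaryGroup_iff.mp hh
      rw [← tendsto_nhds_unique hDlim h1, star_eq_conjTranspose]
      calc (x : Mat d) = (h * hᴴ) * x * (h * hᴴ) := by rw [e, one_mul, mul_one]
        _ = _ := by simp only [mul_assoc]
  have hgoal : Filter.Tendsto
      (fun y => 2 * trace (diagonal (F y) * iwaAlpha (g * H y))) U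
      (nhds (2 * trace (diagonal f * iwaAlpha (g * h)))) := by
    have hu : IsUnit (g * h) := hg.mul (isUnit_of_mem_unitaryGroup hh)
    simp only [fun y => two_mul_trace_iwaAlpha
      (hg.mul (isUnit_of_mem_unitaryGroup (hs y).1)) (F y), two_mul_trace_iwaAlpha hu f]
    refine tendsto_finsetSum _ fun i _ => (hFlim i).mul (Filter.Tendsto.sub ?_ ?_)
    · exact (continuousAt_log_leadingMinor hu _).tendsto.comp hHlim
    · exact (continuousAt_log_leadingMinor hu _).tendsto.comp hHlim
  rw [trace_iwaAlpha_eq_of_isOrderedDiagonalization hx (hs x) hg] at hgoal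
  exact hgoal

theorem stmt10 (d : ℕ) (hd : 1 ≤ d) (ρ : Mat d) (hρ : ρ.PosSemidef) (hρ0 : ρ ≠ 0) :
    LowerSemicontinuous (fun x : {x : Mat d // x.IsHermitian} => rate ρ (↑x : Mat d)) := by
  refine lowerSemicontinuous_iSup fun g => Continuous.lowerSemicontinuous ?_
  exact continuous_coe_real_ereal.comp
    ((continuous_log_chi (g⁻¹).isUnit).neg.sub continuous_const)

end
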